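/- Let P be a penny configuration in general position, let L, U, R, D ∈ P form a kernel, and let X ∈ P \ {L,U,R,D} be a point such that dist(X,K₁) = 1 for some K₁ ∈ {L,U,R,D}, and such that there exists Y ∈ P \ {L,U,R,D} with dist(X,Y) = 1 and dist(Y,K₂) = 1 for some K₂ ∈ {L,U,R,D} with K₂ ≠ K₁. Then X does not belong to any kernel, i.e., there is no kernel of P having X as one of its four points. -/

import Mathlib

open Real EuclideanGeometry

/-- The Euclidean plane. -/
abbrev Pt := EuclideanSpace ℝ (Fin 2)

/-- A penny configuration in general position: a finite set of points in the plane
such that any two distinct points are at distance at least 1 and no three points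
are collinear. -/
def PennyGP (P : Finset Pt) : Prop :=
  (∀ p ∈ P, ∀ q ∈ P, p ≠ q → 1 ≤ dist p q) ∧
  (∀ p ∈ P, ∀ q ∈ P, ∀ r ∈ P, p ≠ q → p ≠ r → q ≠ r →
    ¬ Collinear ℝ ({p, q, r} : Set Pt))

/-- The degree of a point `A` in the penny graph of `P`: the number of points of `P`
at distance exactly 1 from `A`. -/
noncomputable def deg (P : Finset Pt) (A : Pt) : ℕ :=
  {q : Pt | q ∈ P ∧ dist A q = 1}.ncard

/-- A kernel: four distinct points of `P`, each of degree 5, with the five unit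
distances `LU`, `UR`, `RD`, `DL`, `LR`. -/
def IsKernel (P : Finset Pt) (L U R D : Pt) : Prop :=
  L ∈ P ∧ U ∈ P ∧ R ∈ P ∧ D ∈ P ∧
  List.Pairwise (· ≠ ·) [L, U, R, D] ∧
  deg P L = 5 ∧ deg P U = 5 ∧ deg P R = 5 ∧ deg P D = 5 ∧
  dist L U = 1 ∧ dist U R = 1 ∧ dist R D = 1 ∧ dist D L = 1 ∧ dist L R = 1

/-- A point belongs to a kernel if it is one of the four points of some kernel of `P`. -/
def InKernel (P : Finset Pt) (X : Pt) : Prop :=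
  ∃ L U R D : Pt, IsKernel P L U R D ∧ X ∈ ({L, U, R, D} : Set Pt)

/-- The unit vector of the plane with polar angle `θ`. -/
noncomputable def polarUnit (θ : ℝ) : Pt := !₂[cos θ, sin θ]

@[simp] lemma polarUnit_apply_zero (θ : ℝ) : polarUnit θ 0 = cos θ := rfl

@[simp] lemma polarUnit_apply_one (θ : ℝ) : polarUnit θ 1 = sin θ := rfl

lemma polarUnit_add_pi (θ : ℝ) : polarUnit (θ + π) = -polarUnit θ := by
  ext i; fin_cases i <;> simp [polarUnit]

lemma polarUnit_add_two_pi (θ : ℝ) : polarUnit (θ + 2 * π) = polarUnit θ := by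
  ext i; fin_cases i <;> simp [polarUnit]

lemma polarUnit_add_int_mul_two_pi (θ : ℝ) (n : ℤ) :
    polarUnit (θ + n * (2 * π)) = polarUnit θ := by
  ext i; fin_cases i <;> simp [polarUnit]

lemma polarUnit_add_polarUnit (θ φ : ℝ) :
    polarUnit θ + polarUnit φ = (2 * cos ((θ - φ) / 2)) • polarUnit ((θ + φ) / 2) := by
  ext i; fin_cases i
  · simpa [polarUnit] using by rw [cos_add_cos]; ring
  · simpa [polarUnit] using by rw [sin_add_sin]; ring

lemma polarUnit_add_polarUnit_of_sub_eq {θ φ : ℝ} (h : φ - θ = 2 * π / 3) :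
    polarUnit θ + polarUnit φ = polarUnit (θ + π / 3) := by
  rw [polarUnit_add_polarUnit, show (θ - φ) / 2 = -(π / 3) by linarith, cos_neg, cos_pi_div_three,
    show (θ + φ) / 2 = θ + π / 3 by linarith]
  simp

lemma dist_sq_eq_coords (A B : Pt) : dist A B ^ 2 = (A 0 - B 0) ^ 2 + (A 1 - B 1) ^ 2 := by
  rw [EuclideanSpace.dist_eq, Real.sq_sqrt (by positivity)]
  simp [Fin.sum_univ_two, Real.dist_eq]

lemma dist_add_polarUnit_sq (A : Pt) (θ φ : ℝ) :
    dist (A + polarUnit θ) (A + polarUnit φ) ^ 2 = 2 - 2 * cos (θ - φ) := by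
  rw [dist_sq_eq_coords, cos_sub]
  simp
  linear_combination sin_sq_add_cos_sq θ + sin_sq_add_cos_sq φ

lemma dist_self_add_polarUnit (A : Pt) (θ : ℝ) : dist A (A + polarUnit θ) = 1 := by
  rw [← sq_eq_sq₀ dist_nonneg zero_le_one, dist_sq_eq_coords]
  simp

lemma exists_polarUnit_of_dist_eq_one (s : ℝ) {A q : Pt} (h : dist A q = 1) :
    ∃ θ ∈ Set.Ico s (s + 2 * π), A + polarUnit θ = q := by
  obtain ⟨z, hz⟩ : ∃ z : ℂ, z = ⟨q 0 - A 0, q 1 - A 1⟩ := ⟨_, rfl⟩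
  have hn : ‖z‖ = 1 := by
    rw [← sq_eq_sq₀ (norm_nonneg _) zero_le_one, ← Complex.normSq_eq_norm_sq,
      Complex.normSq_apply]
    have := dist_sq_eq_coords A q
    rw [h] at this
    simp only [hz]
    linarith
  have hre := Complex.norm_mul_cos_arg z
  have him := Complex.norm_mul_sin_arg z
  rw [hn, one_mul] at hre him
  refine ⟨toIcoMod two_pi_pos s z.arg, toIcoMod_mem_Ico _ _ _, ?_⟩
  have hmod := toIcoMod_add_toIcoDiv_zsmul two_pi_pos s z.arg
  rw [zsmul_eq_mul] at hmod
  rw [← polarUnit_add_int_mul_two_pi _ (toIcoDiv two_pi_pos s z.arg), hmod]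
  ext i; fin_cases i
  · simp [hre]; simp [hz]
  · simp [him]; simp [hz]

lemma mem_Icc_of_cos_le_half {d : ℝ} (h0 : 0 < d) (h1 : d < 2 * π) (h : cos d ≤ 1 / 2) :
    d ∈ Set.Icc (π / 3) (5 * π / 3) := by
  have hpi := pi_pos
  rw [← cos_pi_div_three] at h
  constructor
  · by_contra! hd
    exact absurd (cos_lt_cos_of_nonneg_of_le_pi h0.le (by linarith) hd) h.not_gt
  · by_contra! hd
    have := cos_lt_cos_of_nonneg_of_le_pi (x := 2 * π - d) (y := π / 3)
      (by linarith) (by linarith) (by linarith)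
    rw [cos_two_pi_sub] at this
    exact absurd this h.not_gt

lemma PennyGP.sub_mem_Icc {P : Finset Pt} (hP : PennyGP P) {A : Pt} {θ φ : ℝ}
    (hθ : A + polarUnit θ ∈ P) (hφ : A + polarUnit φ ∈ P) (h : θ < φ) (h' : φ < θ + 2 * π) :
    φ - θ ∈ Set.Icc (π / 3) (5 * π / 3) := by
  have hd := dist_add_polarUnit_sq A φ θ
  refine mem_Icc_of_cos_le_half (by linarith) (by linarith) ?_
  have hne : A + polarUnit φ ≠ A + polarUnit θ := by
    intro he
    rw [he, dist_self] at hd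
    have h1 : cos (φ - θ) = 1 := by linarith
    rw [cos_eq_one_iff_of_lt_of_lt (by linarith) (by linarith)] at h1
    linarith
  have := hP.1 _ hφ _ hθ hne
  nlinarith

lemma PennyGP.notMem_of_opposite {P : Finset Pt} (hP : PennyGP P) {A : Pt} (hA : A ∈ P)
    {θ k l : ℝ} (hk : 0 < k) (hl : 0 < l) (h : A + k • polarUnit θ ∈ P) :
    A - l • polarUnit θ ∉ P := by
  intro h'
  have hu : polarUnit θ ≠ 0 := by
    intro h0
    have := dist_self_add_polarUnit A θ
    simp [h0] at this
  refine hP.2 _ h _ hA _ h' ?_ ?_ ?_ ?_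
  · simp [hk.ne', hu]
  · rw [Ne, ← sub_eq_zero, show A + k • polarUnit θ - (A - l • polarUnit θ)
      = (k + l) • polarUnit θ by module]
    simp [(add_pos hk hl).ne', hu]
  · rw [Ne, ← sub_eq_zero]
    simp [hl.ne', hu]
  · rw [collinear_iff_of_mem (p₀ := A) (by simp)]
    refine ⟨polarUnit θ, fun p hp => ?_⟩
    rcases hp with rfl | rfl | rfl
    · exact ⟨k, by simp [add_comm]⟩
    · exact ⟨0, by simp⟩
    · exact ⟨-l, by simp [sub_eq_add_neg, add_comm]⟩

lemma PennyGP.notMem_of_antipodal {P : Finset Pt} (hP : PennyGP P) {A : Pt} (hA : A ∈ P)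
    {θ φ : ℝ} (h : A + polarUnit θ ∈ P) (hφ : φ = θ + π) : A + polarUnit φ ∉ P := by
  rw [hφ, polarUnit_add_pi, ← sub_eq_add_neg]
  simpa using hP.notMem_of_opposite (θ := θ) hA one_pos one_pos (by simpa using h)

/-- Three of the neighbors of a point of degree 5, listed counterclockwise after one in
direction `s`. -/
lemma PennyGP.exists_neighbor_angles {P : Finset Pt} (hP : PennyGP P) {A : Pt}
    (hdeg : deg P A = 5) {s : ℝ} (hs : A + polarUnit s ∈ P) :
    ∃ a b c : ℝ, A + polarUnit a ∈ P ∧ A + polarUnit b ∈ P ∧ A + polarUnit c ∈ P ∧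
      s + π / 3 ≤ a ∧ a + π / 3 ≤ b ∧ b + π / 3 ≤ c ∧ c ≤ s + 4 * π / 3 := by
  classical
  have hpi := pi_pos
  set N : Finset Pt := P.filter (fun q => dist A q = 1) with hN
  have hcard : N.card = 5 := by
    rw [← hdeg, deg, ← Set.ncard_coe_finset]
    simp [hN]
  have hex : ∀ q ∈ N, ∃ θ, θ ∈ Set.Ico s (s + 2 * π) ∧ A + polarUnit θ = q := fun q hq =>
    exists_polarUnit_of_dist_eq_one s (Finset.mem_filter.1 hq).2
  choose! f hf hfq using hex
  have hinj : Set.InjOn f N := fun p hp q hq h => by rw [← hfq p hp, ← hfq q hq, h]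
  have hSc : (N.image f).card = 5 := by rw [Finset.card_image_of_injOn hinj, hcard]
  set g := (N.image f).orderEmbOfFin hSc with hg
  have hgm : ∀ i, A + polarUnit (g i) ∈ P ∧ g i ∈ Set.Ico s (s + 2 * π) := by
    intro i
    obtain ⟨q, hq, hqi⟩ := Finset.mem_image.1 ((N.image f).orderEmbOfFin_mem hSc i)
    rw [hg, ← hqi, hfq q hq]
    exact ⟨(Finset.mem_filter.1 hq).1, hf q hq⟩
  have hg0 : g 0 = s := by
    have hsN : A + polarUnit s ∈ N := Finset.mem_filter.2 ⟨hs, dist_self_add_polarUnit A s⟩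
    obtain ⟨hr₁, hr₂⟩ := hf _ hsN
    have hd := dist_add_polarUnit_sq A (f (A + polarUnit s)) s
    rw [hfq _ hsN, dist_self] at hd
    have hc : cos (f (A + polarUnit s) - s) = 1 := by linarith
    rw [cos_eq_one_iff_of_lt_of_lt (by linarith) (by linarith), sub_eq_zero] at hc
    have hsg : s ∈ Set.range g := by
      rw [hg, Finset.range_orderEmbOfFin]
      exact Finset.mem_coe.2 (Finset.mem_image.2 ⟨_, hsN, hc⟩)
    obtain ⟨i, hi⟩ := hsg
    exact le_antisymm (hi ▸ g.monotone (Fin.zero_le i)) (hgm 0).2.1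
  have hgap : ∀ i j, i < j → g j - g i ∈ Set.Icc (π / 3) (5 * π / 3) := fun i j hij =>
    hP.sub_mem_Icc (hgm i).1 (hgm j).1 (g.strictMono hij)
      (by linarith [(hgm j).2.2, (hgm i).2.1])
  refine ⟨g 1, g 2, g 3, (hgm 1).1, (hgm 2).1, (hgm 3).1, ?_, ?_, ?_, ?_⟩
  · linarith [(hgap 0 1 (by decide)).1]
  · linarith [(hgap 1 2 (by decide)).1]
  · linarith [(hgap 2 3 (by decide)).1]
  · linarith [(hgap 3 4 (by decide)).1, (hgap 0 4 (by decide)).2]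

/-- For adjacent points `A` and `B = A + polarUnit c`, a neighbor of `B` and a neighbor of `A`
on the same side of `AB` cannot lean towards each other. -/
lemma PennyGP.angle_le_of_adjacent {P : Finset Pt} (hP : PennyGP P) {A B : Pt} {c x y : ℝ}
    (hB : B = A + polarUnit c) (hx : B + polarUnit x ∈ P) (hy : A + polarUnit y ∈ P)
    (hn : A + polarUnit (c - π / 3) ∉ P) (hx₁ : c - 2 * π / 3 ≤ x) (hy₂ : y ≤ c - π / 3) :
    y ≤ x := by
  subst hB
  have hpi := pi_pos
  by_contra! hxy
  have hd : dist (A + polarUnit c + polarUnit x) (A + polarUnit y) ^ 2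
      = 3 + 2 * cos (c - x) - 2 * cos (c - y) - 2 * cos ((c - x) - (c - y)) := by
    rw [dist_sq_eq_coords, show (c - x) - (c - y) = y - x by ring, cos_sub, cos_sub, cos_sub]
    simp
    linear_combination sin_sq_add_cos_sq c + sin_sq_add_cos_sq x + sin_sq_add_cos_sq y
  by_cases he : A + polarUnit c + polarUnit x = A + polarUnit y
  · have hq : dist (A + polarUnit c) (A + polarUnit c + polarUnit x) ^ 2 = 1 := by
      rw [dist_self_add_polarUnit, one_pow]
    rw [he, dist_add_polarUnit_sq] at hq
    have hcy : cos (c - y) = cos (π / 3) := by rw [cos_pi_div_three]; linarith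
    have := injOn_cos ⟨by linarith, by linarith⟩ ⟨by linarith, by linarith⟩ hcy
    exact hn (by rwa [show c - π / 3 = y by linarith])
  · have h1 := hP.1 _ hx _ hy he
    have h2 : 1 ≤ dist (A + polarUnit c + polarUnit x) (A + polarUnit y) ^ 2 := by nlinarith
    rw [hd] at h2
    set X := c - x with hX
    set Y := c - y with hY
    have e1 : cos (X - Y) = 1 - 2 * sin ((X - Y) / 2) ^ 2 := by
      rw [← cos_two_mul_eq_one_sub, mul_div_cancel₀ _ two_ne_zero]
    have e2 := cos_sub_cos X Y
    have e3 := sin_sub_sin ((X + Y) / 2) ((X - Y) / 2)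
    rw [show ((X + Y) / 2 - (X - Y) / 2) / 2 = Y / 2 by ring,
      show ((X + Y) / 2 + (X - Y) / 2) / 2 = X / 2 by ring] at e3
    have p1 : 0 < sin (Y / 2) := sin_pos_of_pos_of_lt_pi (by linarith) (by linarith)
    have p2 : 0 < cos (X / 2) := cos_pos_of_mem_Ioo ⟨by linarith, by linarith⟩
    have p3 : 0 < sin ((X - Y) / 2) := sin_pos_of_pos_of_lt_pi (by linarith) (by linarith)
    have p4 : 0 < sin ((X - Y) / 2) * (sin (Y / 2) * cos (X / 2)) := by positivity
    nlinarith

/-- The angles of a point at distance 1 from the ends of the segment from `A` to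
`A + polarUnit γ`. -/
lemma eq_add_polarUnit_of_dist_eq_one {A B : Pt} {γ : ℝ} (hA : dist A B = 1)
    (hB : dist B (A + polarUnit γ) = 1) :
    B = A + polarUnit (γ + π / 3) ∨ B = A + polarUnit (γ - π / 3) := by
  have hpi := pi_pos
  obtain ⟨θ, ⟨h1, h2⟩, rfl⟩ := exists_polarUnit_of_dist_eq_one γ hA
  have hd := dist_add_polarUnit_sq A θ γ
  rw [hB] at hd
  have hc : cos (θ - γ) = cos (π / 3) := by rw [cos_pi_div_three]; linarith
  rcases le_total (θ - γ) π with h | h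
  · left
    have := injOn_cos ⟨by linarith, h⟩ ⟨by linarith, by linarith⟩ hc
    rw [show θ = γ + π / 3 by linarith]
  · right
    rw [← cos_two_pi_sub] at hc
    have := injOn_cos ⟨by linarith, by linarith⟩ ⟨by linarith, by linarith⟩ hc
    rw [← polarUnit_add_two_pi (γ - π / 3), show θ = γ - π / 3 + 2 * π by linarith]

/-- There are no kernels `L, U, R, D` with `U` counterclockwise from `R` around `L`. -/
lemma PennyGP.false_of_oriented_kernel {P : Finset Pt} (hP : PennyGP P) {L U R D : Pt} {γ : ℝ}
    (hk : IsKernel P L U R D) (hR : R = L + polarUnit γ) (hU : U = L + polarUnit (γ + π / 3))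
    (hD : D = L + polarUnit (γ - π / 3)) : False := by
  have hpi := pi_pos
  obtain ⟨mL, mU, mR, mD, -, dL, dU, dR, dD, -⟩ := hk
  have shift {A B : Pt} {θ : ℝ} (φ : ℝ) (h : B = A + polarUnit θ) (hφ : φ = θ + 2 * π) :
      B = A + polarUnit φ := by rw [hφ, polarUnit_add_two_pi, h]
  have rev {A B : Pt} {θ : ℝ} (φ : ℝ) (h : B = A + polarUnit θ) (hφ : φ = θ + π) :
      A = B + polarUnit φ := by rw [hφ, polarUnit_add_pi, h]; abel
  -- The sides of the kernel, with the angles normalized for a counterclockwise walk around it.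
  have RU : U = R + polarUnit (γ + 2 * π / 3) := by
    rw [hU, hR, add_assoc, polarUnit_add_polarUnit_of_sub_eq (by ring)]
  have DR : R = D + polarUnit (γ + π / 3) := by
    rw [hD, hR, add_assoc, polarUnit_add_polarUnit_of_sub_eq (by ring), sub_add_cancel]
  have UR : R = U + polarUnit (γ - π / 3) := by
    rw [RU, add_assoc, show γ + 2 * π / 3 = γ - π / 3 + π by ring, polarUnit_add_pi]
    simp
  have UL : L = U + polarUnit (γ + 4 * π / 3) := rev _ hU (by ring)
  have DL : L = D + polarUnit (γ + 2 * π / 3) := rev _ hD (by ring)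
  have RD : D = R + polarUnit (γ + 4 * π / 3) := rev _ DR (by ring)
  have LD : D = L + polarUnit (γ + 5 * π / 3) := shift _ hD (by ring)
  obtain ⟨t₁, t₂, t₃, mt₁, mt₂, mt₃, ht₁, ht₂, ht₃, ht₄⟩ :=
    hP.exists_neighbor_angles dU (UR ▸ mR)
  obtain ⟨a, b, c, ma, mb, -, ha, hab, hb, hb'⟩ := hP.exists_neighbor_angles dL (hU ▸ mU)
  obtain ⟨u₁, u₂, u₃, mu₁, mu₂, mu₃, hu₁, hu₂, hu₃, hu₄⟩ :=
    hP.exists_neighbor_angles dD (DL ▸ mL)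
  obtain ⟨β, α, ε, mβ, mα, -, hβ, hαβ, hα, hα'⟩ := hP.exists_neighbor_angles dR (RD ▸ mD)
  have sideRU : α ≤ t₁ + 2 * π := by
    refine hP.angle_le_of_adjacent (shift (γ + 8 * π / 3) RU (by ring))
      (by rwa [polarUnit_add_two_pi]) mα ?_ (by linarith) (by linarith)
    exact hP.notMem_of_antipodal mR (RD ▸ mD) (by ring)
  have sideUL : t₃ ≤ a := by
    refine hP.angle_le_of_adjacent UL ma mt₃ ?_ (by linarith) (by linarith)
    rw [hU, add_assoc, polarUnit_add_polarUnit_of_sub_eq (by ring)]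
    exact hP.notMem_of_antipodal mL (hD ▸ mD) (by ring)
  have sideLD : b ≤ u₁ := by
    refine hP.angle_le_of_adjacent LD mu₁ mb ?_ (by linarith) (by linarith)
    exact hP.notMem_of_antipodal mL (hU ▸ mU) (by ring)
  have sideDR : u₃ ≤ β := by
    refine hP.angle_le_of_adjacent (shift (γ + 7 * π / 3) DR (by ring)) mβ mu₃ ?_
      (by linarith) (by linarith)
    rw [RD, add_assoc, polarUnit_add_polarUnit_of_sub_eq (by ring)]
    exact hP.notMem_of_antipodal mR (RU ▸ mU) (by ring)
  -- The angles make a full turn in six steps of at least `π / 3`, so all steps are `π / 3`, and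
  -- `U + polarUnit t₂` and `D + polarUnit u₃` are on opposite sides of `R`.
  have et : t₂ = α - 5 * π / 3 := by linarith
  have eu : u₃ = α - π / 3 := by linarith
  rw [et, RU, add_assoc, polarUnit_add_polarUnit] at mt₂
  rw [eu, RD, add_assoc, polarUnit_add_polarUnit,
    show (γ + 4 * π / 3 + (α - π / 3)) / 2 = (γ + 2 * π / 3 + (α - 5 * π / 3)) / 2 + π by ring,
    polarUnit_add_pi, smul_neg, ← sub_eq_add_neg] at mu₃
  refine hP.notMem_of_opposite mR ?_ ?_ mt₂ mu₃
  · exact mul_pos two_pos (cos_pos_of_mem_Ioo ⟨by linarith, by linarith⟩)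
  · exact mul_pos two_pos (cos_pos_of_mem_Ioo ⟨by linarith, by linarith⟩)

lemma IsKernel.swap {P : Finset Pt} {L U R D : Pt} (h : IsKernel P L U R D) :
    IsKernel P L D R U := by
  obtain ⟨mL, mU, mR, mD, hp, dL, dU, dR, dD, h₁, h₂, h₃, h₄, h₅⟩ := h
  simp only [List.pairwise_cons, List.mem_cons, List.not_mem_nil] at hp
  refine ⟨mL, mD, mR, mU, ?_, dL, dD, dR, dU, ?_⟩
  · simp
    grind
  · simp only [dist_comm] at *
    grind

/-- A penny configuration in general position has no kernels: the degree condition determines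
the neighbors of a kernel up to one angle, and two of them are collinear with a kernel point. -/
lemma PennyGP.not_isKernel {P : Finset Pt} (hP : PennyGP P) (L U R D : Pt) :
    ¬ IsKernel P L U R D := by
  intro hk
  obtain ⟨-, -, -, -, hp, -, -, -, -, hLU, hUR, hRD, hDL, hLR⟩ := id hk
  obtain ⟨γ, -, rfl⟩ := exists_polarUnit_of_dist_eq_one 0 hLR
  have hUD : U ≠ D := by simp at hp; tauto
  rcases eq_add_polarUnit_of_dist_eq_one hLU hUR with hU | hU <;>
    rcases eq_add_polarUnit_of_dist_eq_one ((dist_comm _ _).trans hDL)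
      ((dist_comm _ _).trans hRD) with hD | hD
  · exact hUD (hU.trans hD.symm)
  · exact hP.false_of_oriented_kernel hk rfl hU hD
  · exact hP.false_of_oriented_kernel hk.swap rfl hD hU
  · exact hUD (hU.trans hD.symm)

/-- Let `L U R D` be a kernel, and let `X ∈ P` be a point outside the kernel at unit
distance from some kernel point `K₁`, which has a unit-neighbor `Y` outside the kernel
at unit distance from some kernel point `K₂ ≠ K₁`. Then `X` does not belong to any kernel. -/
theorem apricot_point_not_in_kernel (P : Finset Pt) (hP : PennyGP P)
    (L U R D X : Pt) (hk : IsKernel P L U R D)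
    (hX : X ∈ P) (hXn : X ∉ ({L, U, R, D} : Set Pt))
    (hK₁ : ∃ K₁ ∈ ({L, U, R, D} : Set Pt), dist X K₁ = 1 ∧
      ∃ Y ∈ P, Y ∉ ({L, U, R, D} : Set Pt) ∧ dist X Y = 1 ∧
        ∃ K₂ ∈ ({L, U, R, D} : Set Pt), K₂ ≠ K₁ ∧ dist Y K₂ = 1) :
    ¬ InKernel P X := by
  rintro ⟨L', U', R', D', h, -⟩
  exact hP.not_isKernel L' U' R' D' h
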